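/- 2^{1/3} · P(5/6, 7/6) = P(1/6, 5/6), and P(1/6, 5/6) = (1 + √3) · P(2/3, 4/3). -/

import Mathlib

open Real

/-- Ascending Pochhammer symbol `(x)_k = x(x+1)⋯(x+k−1)`. -/
noncomputable def poch (x : ℝ) (k : ℕ) : ℝ := (ascPochhammer ℝ k).eval x

/-- The Beta function quotient `B(x,y) = Γ(x)Γ(y)/Γ(x+y)`. -/
noncomputable def betaR (x y : ℝ) : ℝ := Gamma x * Gamma y / Gamma (x + y)

/-- Generalized hypergeometric series `₃F₂(a₁,a₂,a₃; b₁,b₂; z)`. -/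
noncomputable def F32 (a1 a2 a3 b1 b2 z : ℝ) : ℝ :=
  ∑' k : ℕ, (poch a1 k * poch a2 k * poch a3 k)
      / (poch b1 k * poch b2 k * (k.factorial : ℝ)) * z ^ k

/-- The hypergeometric period value `P(r,s) = π · B(r, s−r) · ₃F₂(1/2,1/2,r; 1,s; 1)`. -/
noncomputable def P (r s : ℝ) : ℝ := π * betaR r (s - r) * F32 (1/2) (1/2) r 1 s 1

open Filter Topology

lemma poch_zero (x : ℝ) : poch x 0 = 1 := by simp [poch]

lemma poch_succ (x : ℝ) (k : ℕ) : poch x (k + 1) = poch x k * (x + k) := by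
  simp [poch, ascPochhammer_succ_eval]

lemma poch_pos {x : ℝ} (hx : 0 < x) (k : ℕ) : 0 < poch x k := ascPochhammer_pos k x hx

lemma mul_poch_add_one (x : ℝ) (k : ℕ) : x * poch (x + 1) k = poch x k * (x + k) := by
  induction k with
  | zero => simp [poch_zero]
  | succ k ih =>
    rw [poch_succ, poch_succ, ← mul_assoc, ih]
    push_cast
    ring

lemma mul_poch_add_two (x : ℝ) (k : ℕ) :
    x * (x + 1) * poch (x + 2) k = poch x k * (x + k) * (x + k + 1) := by
  have h := mul_poch_add_one (x + 1) k
  rw [show x + 1 + 1 = x + 2 by ring] at h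
  rw [mul_assoc, h, ← mul_assoc, mul_poch_add_one]
  ring

lemma poch_one (k : ℕ) : poch 1 k = k.factorial := by simp [poch]

lemma Gamma_add_nat {x : ℝ} (hx : 0 < x) (k : ℕ) : Gamma (x + k) = poch x k * Gamma x := by
  induction k with
  | zero => simp [poch_zero]
  | succ k ih =>
    have : x + k ≠ 0 := by positivity
    rw [poch_succ, Nat.cast_succ, ← add_assoc, Gamma_add_one this, ih]
    ring

lemma poch_eq_prod (x : ℝ) (k : ℕ) : poch x k = ∏ j ∈ Finset.range k, (x + j) := by
  induction k with
  | zero => simp [poch_zero]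
  | succ k ih => rw [poch_succ, ih, Finset.prod_range_succ]

/-- The Pochhammer form of Euler's limit formula for `1 / Γ`. -/
lemma tendsto_poch_div {x : ℝ} (hx : 0 < x) :
    Tendsto (fun n : ℕ => poch x (n + 1) / ((n : ℝ) ^ x * n.factorial)) atTop
      (𝓝 (Gamma x)⁻¹) := by
  refine ((GammaSeq_tendsto_Gamma x).inv₀ (Gamma_pos_of_pos hx).ne').congr fun n => ?_
  rw [GammaSeq, inv_div, poch_eq_prod]

lemma tendsto_poch_ratio {x₁ x₂ y₁ y₂ : ℝ} (hx₁ : 0 < x₁) (hx₂ : 0 < x₂) (hy₁ : 0 < y₁)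
    (hy₂ : 0 < y₂) (h : x₁ + x₂ = y₁ + y₂) :
    Tendsto (fun n : ℕ => poch x₁ n * poch x₂ n / (poch y₁ n * poch y₂ n)) atTop
      (𝓝 (Gamma y₁ * Gamma y₂ / (Gamma x₁ * Gamma x₂))) := by
  rw [← tendsto_add_atTop_iff_nat 1]
  have hg := fun {x : ℝ} (hx : 0 < x) => (Gamma_pos_of_pos hx).ne'
  have key := ((tendsto_poch_div hx₁).mul (tendsto_poch_div hx₂)).div
    ((tendsto_poch_div hy₁).mul (tendsto_poch_div hy₂))
    (mul_ne_zero (inv_ne_zero (hg hy₁)) (inv_ne_zero (hg hy₂)))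
  convert key.congr' ?_ using 2
  · have := hg hx₁; have := hg hx₂; have := hg hy₁; have := hg hy₂
    field_simp
  · filter_upwards [eventually_gt_atTop 0] with n hn
    have hn' : (0 : ℝ) < n := by exact_mod_cast hn
    have h1 : (n : ℝ) ^ x₁ * (n : ℝ) ^ x₂ = (n : ℝ) ^ y₁ * (n : ℝ) ^ y₂ := by
      rw [← rpow_add hn', ← rpow_add hn', h]
    have := (poch_pos hy₁ (n + 1)).ne'
    have := (poch_pos hy₂ (n + 1)).ne'
    have := (rpow_pos_of_pos hn' x₁).ne'
    have := (rpow_pos_of_pos hn' x₂).ne'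
    have := (rpow_pos_of_pos hn' y₁).ne'
    have := (rpow_pos_of_pos hn' y₂).ne'
    have hf : (n.factorial : ℝ) ≠ 0 := by positivity
    simp only [Pi.div_apply]
    field_simp
    linear_combination (-(poch x₁ (n + 1) * poch x₂ (n + 1))) * h1

/-- The `k`-th term of the series `₃F₂(a, b, c; d, e; 1)`. -/
noncomputable def hyperTerm (a b c d e : ℝ) (k : ℕ) : ℝ :=
  poch a k * poch b k * poch c k / (poch d k * poch e k * k.factorial)

lemma F32_one (a b c d e : ℝ) : F32 a b c d e 1 = ∑' k, hyperTerm a b c d e k := by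
  simp [F32, hyperTerm]

lemma hyperTerm_zero (a b c d e : ℝ) : hyperTerm a b c d e 0 = 1 := by
  simp [hyperTerm, poch_zero]

lemma hyperTerm_pos {a b c d e : ℝ} (ha : 0 < a) (hb : 0 < b) (hc : 0 < c) (hd : 0 < d)
    (he : 0 < e) (k : ℕ) : 0 < hyperTerm a b c d e k := by
  have := poch_pos ha k; have := poch_pos hb k; have := poch_pos hc k
  have := poch_pos hd k; have := poch_pos he k
  unfold hyperTerm
  positivity

lemma hyperTerm_succ {a b c d e : ℝ} (hd : 0 < d) (he : 0 < e) (k : ℕ) :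
    hyperTerm a b c d e (k + 1) =
      hyperTerm a b c d e k * ((a + k) * (b + k) * (c + k) / ((d + k) * (e + k) * (k + 1))) := by
  have := (poch_pos hd k).ne'; have := (poch_pos he k).ne'
  have : d + k ≠ 0 := by positivity
  have : e + k ≠ 0 := by positivity
  simp only [hyperTerm, poch_succ, Nat.factorial_succ]
  push_cast
  field_simp

lemma tendsto_hyperTerm {a b c d e : ℝ} (ha : 0 < a) (hb : 0 < b) (hc : 0 < c) (hd : 0 < d)
    (he : 0 < e) :
    Tendsto (fun k : ℕ => hyperTerm a b c d e (k + 1) * (k + 1) * (k : ℝ) ^ (d + e - a - b - c))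
      atTop (𝓝 (Gamma d * Gamma e / (Gamma a * Gamma b * Gamma c))) := by
  have hg := fun {x : ℝ} (hx : 0 < x) => (Gamma_pos_of_pos hx).ne'
  have key := (((tendsto_poch_div ha).mul (tendsto_poch_div hb)).mul (tendsto_poch_div hc)).div
    ((tendsto_poch_div hd).mul (tendsto_poch_div he))
    (mul_ne_zero (inv_ne_zero (hg hd)) (inv_ne_zero (hg he)))
  convert key.congr' ?_ using 2
  · have := hg ha; have := hg hb; have := hg hc; have := hg hd; have := hg he
    field_simp
  · filter_upwards [eventually_gt_atTop 0] with n hn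
    have hn' : (0 : ℝ) < n := by exact_mod_cast hn
    have := (poch_pos hd (n + 1)).ne'
    have := (poch_pos he (n + 1)).ne'
    have := (rpow_pos_of_pos hn' a).ne'
    have := (rpow_pos_of_pos hn' b).ne'
    have := (rpow_pos_of_pos hn' c).ne'
    have := (rpow_pos_of_pos hn' d).ne'
    have := (rpow_pos_of_pos hn' e).ne'
    have hf : (n.factorial : ℝ) ≠ 0 := by positivity
    simp only [Pi.div_apply, hyperTerm, Nat.factorial_succ, rpow_sub hn', rpow_add hn']
    push_cast
    field_simp

lemma summable_hyperTerm {a b c d e : ℝ} (ha : 0 < a) (hb : 0 < b) (hc : 0 < c) (hd : 0 < d)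
    (he : 0 < e) (hs : 0 < d + e - a - b - c) : Summable (hyperTerm a b c d e) := by
  rw [← summable_nat_add_iff 1]
  refine summable_of_isBigO_nat
    (summable_nat_rpow.2 (show -1 - (d + e - a - b - c) < -1 by linarith)) ?_
  have h := ((tendsto_hyperTerm ha hb hc hd he).isBigO_one ℝ).mul
    (Asymptotics.isBigO_refl (fun n : ℕ => (n : ℝ) ^ (-1 - (d + e - a - b - c))) atTop)
  simp only [one_mul] at h
  refine Asymptotics.IsBigO.trans (Asymptotics.IsBigO.of_bound 1 ?_) h
  filter_upwards [eventually_gt_atTop 0] with n hn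
  have hn' : (0 : ℝ) < n := by exact_mod_cast hn
  have hp := hyperTerm_pos ha hb hc hd he (n + 1)
  have e1 : hyperTerm a b c d e (n + 1) * (n + 1) * (n : ℝ) ^ (d + e - a - b - c) *
      (n : ℝ) ^ (-1 - (d + e - a - b - c)) = hyperTerm a b c d e (n + 1) * ((n + 1) / n) := by
    rw [mul_assoc, ← rpow_add hn', add_sub_cancel, rpow_neg_one]
    ring
  rw [e1, one_mul, norm_of_nonneg hp.le, norm_of_nonneg (by positivity)]
  exact le_mul_of_one_le_right hp.le ((one_le_div hn').2 (by linarith))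

lemma tendsto_nat_mul_hyperTerm {a b c d e : ℝ} (ha : 0 < a) (hb : 0 < b) (hc : 0 < c)
    (hd : 0 < d) (he : 0 < e) (hs : 0 < d + e - a - b - c) :
    Tendsto (fun k : ℕ => k * hyperTerm a b c d e k) atTop (𝓝 0) := by
  rw [← tendsto_add_atTop_iff_nat 1]
  have h := (tendsto_hyperTerm ha hb hc hd he).mul
    ((tendsto_rpow_neg_atTop hs).comp tendsto_natCast_atTop_atTop)
  rw [mul_zero] at h
  refine h.congr' ?_
  filter_upwards [eventually_gt_atTop 0] with n hn
  have hn' : (0 : ℝ) < n := by exact_mod_cast hn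
  rw [Function.comp_apply, mul_assoc, ← rpow_add hn', add_neg_cancel, rpow_zero]
  push_cast
  ring

lemma tsum_eq_of_telescoping {t u G : ℕ → ℝ} {ρ : ℝ} (ht : Summable t) (hu : Summable u)
    (h : ∀ k, t k - ρ * u k = G (k + 1) - G k) (h0 : G 0 = 0) (hG : Tendsto G atTop (𝓝 0)) :
    ∑' k, t k = ρ * ∑' k, u k := by
  have h1 := (ht.hasSum.sub (hu.hasSum.mul_left ρ)).tendsto_sum_nat
  simp only [h, Finset.sum_range_sub, h0, sub_zero] at h1
  exact sub_eq_zero.1 (tendsto_nhds_unique h1 hG)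

lemma tendsto_tsum_hyperTerm_one {a b c d e : ℝ} {c' d' e' : ℕ → ℝ} (ha : 0 < a) (hb : 0 < b)
    (hc' : ∀ n, 0 < c' n) (hd' : ∀ n, 0 < d' n) (he' : ∀ n, 0 < e' n)
    (hsum : Summable (hyperTerm a b c d e))
    (hle : ∀ n k, hyperTerm a b (c' n) (d' n) (e' n) k ≤ hyperTerm a b c d e k)
    (hlim : ∀ k : ℕ, Tendsto (fun n => (c' n + k) / ((d' n + k) * (e' n + k))) atTop (𝓝 0)) :
    Tendsto (fun n => ∑' k, hyperTerm a b (c' n) (d' n) (e' n) k) atTop (𝓝 1) := by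
  have hterm : ∀ k, Tendsto (fun n => hyperTerm a b (c' n) (d' n) (e' n) k) atTop
      (𝓝 (if k = 0 then 1 else 0)) := by
    intro k
    induction k with
    | zero => simp [hyperTerm_zero]
    | succ k ih =>
      have h := (ih.mul (hlim k)).mul_const ((a + k) * (b + k) / (k + 1))
      rw [mul_zero, zero_mul] at h
      rw [if_neg (Nat.succ_ne_zero k)]
      refine h.congr fun n => ?_
      rw [hyperTerm_succ (hd' n) (he' n)]
      have : d' n + k ≠ 0 := by have := hd' n; positivity
      have : e' n + k ≠ 0 := by have := he' n; positivity
      field_simp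
  have h := tendsto_tsum_of_dominated_convergence hsum hterm (Eventually.of_forall fun n k => by
    rw [norm_of_nonneg (hyperTerm_pos ha hb (hc' n) (hd' n) (he' n) k).le]
    exact hle n k)
  rwa [tsum_ite_eq] at h

lemma poch_le_poch {x y : ℝ} (hx : 0 < x) (hxy : x ≤ y) (k : ℕ) : poch x k ≤ poch y k := by
  simp only [poch_eq_prod]
  exact Finset.prod_le_prod (fun j _ => by positivity) fun j _ => by linarith

lemma gauss_step {a b c : ℝ} (ha : 0 < a) (hb : 0 < b) (hs : 0 < c - a - b) :
    ∑' k, hyperTerm a b 1 c 1 k = (c - a) * (c - b) / (c * (c - a - b)) *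
      ∑' k, hyperTerm a b 1 (c + 1) 1 k := by
  have hc : 0 < c := by linarith
  have ht := tendsto_nat_mul_hyperTerm ha hb one_pos hc one_pos (by linarith)
  refine tsum_eq_of_telescoping (G := fun k => -1 / (c - a - b) * (k * hyperTerm a b 1 c 1 k))
    (summable_hyperTerm ha hb one_pos hc one_pos (by linarith))
    (summable_hyperTerm ha hb one_pos (by linarith) one_pos (by linarith)) (fun k => ?_)
    (by simp) (by simpa using ht.const_mul (-1 / (c - a - b)))
  have hck : c + k ≠ 0 := by positivity
  have h1 : hyperTerm a b 1 (c + 1) 1 k = hyperTerm a b 1 c 1 k * (c / (c + k)) := by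
    have h := mul_poch_add_one c k
    have := (poch_pos (add_pos hc one_pos) k).ne'
    have := (poch_pos hc k).ne'
    have := (poch_pos one_pos k).ne'
    simp only [hyperTerm]
    field_simp
    linear_combination (-(poch a k * poch b k)) * h
  have h1k : (1 : ℝ) + k ≠ 0 := by positivity
  have hk1 : (k : ℝ) + 1 ≠ 0 := by positivity
  rw [h1, hyperTerm_succ hc one_pos]
  push_cast
  field_simp
  ring

/-- Gauss's summation theorem. -/
lemma tsum_gauss {a b c : ℝ} (ha : 0 < a) (hb : 0 < b) (hs : 0 < c - a - b) :
    ∑' k, hyperTerm a b 1 c 1 k =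
      Gamma c * Gamma (c - a - b) / (Gamma (c - a) * Gamma (c - b)) := by
  have hc : 0 < c := by linarith
  have hca : 0 < c - a := by linarith
  have hcb : 0 < c - b := by linarith
  have hiter : ∀ n : ℕ, ∑' k, hyperTerm a b 1 c 1 k =
      poch (c - a) n * poch (c - b) n / (poch c n * poch (c - a - b) n) *
        ∑' k, hyperTerm a b 1 (c + n) 1 k := by
    intro n
    induction n with
    | zero => simp [poch_zero]
    | succ n ih =>
      have hn : (0 : ℝ) ≤ n := n.cast_nonneg
      rw [ih, gauss_step ha hb (by linarith), ← mul_assoc]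
      have := (poch_pos hc n).ne'
      have := (poch_pos hs n).ne'
      have : c + n ≠ 0 := by positivity
      have : c - a - b + n ≠ 0 := by positivity
      have : c + n - a - b ≠ 0 := by linarith
      simp only [poch_succ, Nat.cast_succ, ← add_assoc]
      congr 1
      rw [show c + n - a - b = c - a - b + n by ring, show c + n - a = c - a + n by ring,
        show c + n - b = c - b + n by ring, div_mul_div_comm]
      congr 1 <;> ring
  have hlim : Tendsto (fun n : ℕ => ∑' k, hyperTerm a b 1 (c + n) 1 k) atTop (𝓝 1) := by
    refine tendsto_tsum_hyperTerm_one (c := 1) (d := c) (e := 1) ha hb (fun _ => one_pos)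
      (fun n => by positivity) (fun _ => one_pos)
      (summable_hyperTerm ha hb one_pos hc one_pos (by linarith)) (fun n k => ?_) fun k => ?_
    · have := poch_pos ha k; have := poch_pos hb k; have := poch_pos one_pos k
      have := poch_pos hc k
      have := poch_le_poch hc (le_add_of_nonneg_right n.cast_nonneg : c ≤ c + n) k
      unfold hyperTerm
      gcongr
    · have h : Tendsto (fun n : ℕ => (c + k) + (n : ℝ)) atTop atTop :=
        tendsto_atTop_add_const_left _ _ tendsto_natCast_atTop_atTop
      refine h.inv_tendsto_atTop.congr fun n => ?_
      have : (1 : ℝ) + k ≠ 0 := by positivity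
      rw [Pi.inv_apply, add_right_comm]
      field_simp
  have h := (tendsto_poch_ratio hca hcb hc hs (by ring)).mul hlim
  rw [mul_one] at h
  exact tendsto_nhds_unique (tendsto_const_nhds.congr hiter) h

lemma hasSum_gauss {a b c : ℝ} (ha : 0 < a) (hb : 0 < b) (hs : 0 < c - a - b) :
    HasSum (fun j : ℕ => poch a j * poch b j / (j.factorial * Gamma (c + j)))
      (Gamma (c - a - b) / (Gamma (c - a) * Gamma (c - b))) := by
  have hc : 0 < c := by linarith
  have hg := (Gamma_pos_of_pos hc).ne'
  have h := (summable_hyperTerm ha hb one_pos hc one_pos (by linarith)).hasSum.div_const (Gamma c)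
  rw [tsum_gauss ha hb hs] at h
  convert! h using 1
  · ext j
    have := (poch_pos hc j).ne'
    have : (j.factorial : ℝ) ≠ 0 := by positivity
    rw [hyperTerm, poch_one, Gamma_add_nat hc]
    field_simp
  · field_simp

/-- Thomae's transformation. -/
lemma thomae {a b c d e s : ℝ} (ha : 0 < a) (hb : 0 < b) (hc : 0 < c) (hda : 0 < d - a)
    (hea : 0 < e - a) (hs : 0 < s) (hsum : s + a + b + c = d + e) :
    F32 a b c d e 1 = Gamma d * Gamma e * Gamma s / (Gamma a * Gamma (s + b) * Gamma (s + c)) *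
      F32 (d - a) (e - a) s (s + b) (s + c) 1 := by
  have hd : 0 < d := by linarith
  have he : 0 < e := by linarith
  have hgp := fun {x : ℝ} (hx : 0 < x) => Gamma_pos_of_pos hx
  have hg := fun {x : ℝ} (hx : 0 < x) => (Gamma_pos_of_pos hx).ne'
  let u : ℕ → ℕ → ℝ := fun k j => poch b k * poch c k / k.factorial *
    (poch (d - a) j * poch (e - a) j / (j.factorial * Gamma (d + e - a + k + j)))
  have hu : ∀ k j, 0 ≤ u k j := fun k j => by
    have := poch_pos hb k; have := poch_pos hc k
    have := poch_pos hda j; have := poch_pos hea j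
    have := hgp (show 0 < d + e - a + k + j by
      have : 0 < d + e - a := by linarith
      positivity)
    positivity
  have hrow : ∀ k, HasSum (u k) (hyperTerm a b c d e k * (Gamma a / (Gamma d * Gamma e))) := by
    intro k
    have hk : (0 : ℝ) ≤ k := k.cast_nonneg
    have h := (hasSum_gauss (c := d + e - a + k) hda hea (by linarith)).mul_left
      (poch b k * poch c k / k.factorial)
    rw [show d + e - a + k - (d - a) - (e - a) = a + k by ring,
      show d + e - a + k - (d - a) = e + k by ring,
      show d + e - a + k - (e - a) = d + k by ring, Gamma_add_nat ha, Gamma_add_nat hd,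
      Gamma_add_nat he] at h
    convert! h using 1
    have := (poch_pos hd k).ne'; have := (poch_pos he k).ne'
    have := hg hd; have := hg he
    rw [hyperTerm]
    field_simp
  have hcol : ∀ j, HasSum (fun k => u k j) (hyperTerm (d - a) (e - a) s (s + b) (s + c) j *
      (Gamma s / (Gamma (s + b) * Gamma (s + c)))) := by
    intro j
    have hj : (0 : ℝ) ≤ j := j.cast_nonneg
    have h := (hasSum_gauss (c := d + e - a + j) hb hc (by linarith)).mul_left
      (poch (d - a) j * poch (e - a) j / j.factorial)
    rw [show d + e - a + j - b - c = s + j by linarith,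
      show d + e - a + j - b = s + c + j by linarith,
      show d + e - a + j - c = s + b + j by linarith, Gamma_add_nat hs,
      Gamma_add_nat (show 0 < s + b by linarith), Gamma_add_nat (show 0 < s + c by linarith)] at h
    convert! h using 1
    · ext k
      simp only [u]
      rw [add_right_comm (d + e - a)]
      ring
    · have := (poch_pos (add_pos hs hb) j).ne'; have := (poch_pos (add_pos hs hc) j).ne'
      have := hg (add_pos hs hb); have := hg (add_pos hs hc)
      rw [hyperTerm]
      field_simp
  have hsm : Summable (Function.uncurry u) := by
    rw [summable_prod_of_nonneg (f := Function.uncurry u) fun p => hu p.1 p.2]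
    refine ⟨fun k => (hrow k).summable, ?_⟩
    simp only [Function.uncurry_apply_pair, (hrow _).tsum_eq]
    exact (summable_hyperTerm ha hb hc hd he (by linarith)).mul_right _
  have hswap := hsm.tsum_comm
  simp only [(hrow _).tsum_eq, (hcol _).tsum_eq, tsum_mul_right] at hswap
  rw [F32_one, F32_one]
  have := hg ha; have := hg hd; have := hg he
  have := hg (add_pos hs hb); have := hg (add_pos hs hc)
  field_simp at hswap ⊢
  linear_combination -hswap

lemma whipple_step {a b c e f : ℝ} (ha : 0 < a) (hb : 0 < b) (hab : a + b = 1) (hc : 0 < c)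
    (he : 0 < e) (hf : 0 < f) (hef : e + f = 2 * c + 1) :
    ∑' k, hyperTerm a b c e f k = (a + e) * (b + e) / (e * (e + 1)) *
      ∑' k, hyperTerm a b (c + 1) (e + 2) f k := by
  obtain rfl : b = 1 - a := by linarith
  obtain rfl : f = 2 * c + 1 - e := by linarith
  have ht := tendsto_nat_mul_hyperTerm ha hb hc he hf (by linarith)
  have hr : Tendsto (fun k : ℕ => (2 * c - e + k) / (c * (e + k))) atTop (𝓝 (1 / c)) := by
    have h : Tendsto (fun k : ℕ => e + (k : ℝ)) atTop atTop :=
      tendsto_atTop_add_const_left _ _ tendsto_natCast_atTop_atTop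
    have h2 := (h.inv_tendsto_atTop.const_mul ((2 * c - 2 * e) / c)).const_add (1 / c)
    rw [mul_zero, add_zero] at h2
    refine h2.congr fun k => ?_
    have : e + k ≠ 0 := by positivity
    rw [Pi.inv_apply]
    field_simp
    ring
  refine tsum_eq_of_telescoping
    (G := fun k => -((2 * c - e + k) / (c * (e + k)) * (k * hyperTerm a (1 - a) c e _ k)))
    (summable_hyperTerm ha hb hc he hf (by linarith))
    (summable_hyperTerm ha hb (by linarith) (by linarith) hf (by linarith)) (fun k => ?_)
    (by simp) (by simpa using (hr.mul ht).neg)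
  have hek : e + k ≠ 0 := by positivity
  have hek1 : e + k + 1 ≠ 0 := by positivity
  have hfk : 2 * c + 1 - e + k ≠ 0 := by positivity
  have hk1 : (k : ℝ) + 1 ≠ 0 := by positivity
  have h1 : hyperTerm a (1 - a) (c + 1) (e + 2) (2 * c + 1 - e) k =
      hyperTerm a (1 - a) c e (2 * c + 1 - e) k *
        ((c + k) / c * (e * (e + 1) / ((e + k) * (e + k + 1)))) := by
    have h2 := mul_poch_add_one c k
    have h3 := mul_poch_add_two e k
    have := (poch_pos he k).ne'
    have := (poch_pos hf k).ne'
    have := (poch_pos (show 0 < e + 2 by linarith) k).ne'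
    rw [hyperTerm, hyperTerm, eq_div_of_mul_eq hc.ne' ((mul_comm _ _).trans h2),
      eq_div_of_mul_eq (by positivity) ((mul_comm _ _).trans h3)]
    field_simp
  rw [h1, hyperTerm_succ he hf]
  push_cast
  rw [show e + (k + 1 : ℝ) = e + k + 1 by ring,
    show 2 * c - e + (k + 1 : ℝ) = 2 * c + 1 - e + k by ring]
  field_simp
  ring

lemma hyperTerm_swap (a b c e f : ℝ) (k : ℕ) : hyperTerm a b c e f k = hyperTerm a b c f e k := by
  rw [hyperTerm, hyperTerm, mul_comm (poch e k)]

lemma whipple_double_step {a b c e f : ℝ} (ha : 0 < a) (hb : 0 < b) (hab : a + b = 1) (hc : 0 < c)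
    (he : 0 < e) (hf : 0 < f) (hef : e + f = 2 * c + 1) :
    ∑' k, hyperTerm a b c e f k =
      (a + e) * (b + e) / (e * (e + 1)) * ((a + f) * (b + f) / (f * (f + 1))) *
        ∑' k, hyperTerm a b (c + 2) (e + 2) (f + 2) k := by
  rw [whipple_step ha hb hab hc he hf hef, mul_assoc]
  simp only [hyperTerm_swap _ _ _ _ f]
  rw [whipple_step ha hb hab (by linarith) hf (by linarith) (by linarith)]
  simp only [hyperTerm_swap _ _ _ (f + 2)]
  rw [show c + 1 + 1 = c + 2 by ring]

lemma hyperTerm_shift_le {a b c e f : ℝ} (ha : 0 < a) (hb : 0 < b) (hc : 1 / 2 ≤ c)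
    (he : 0 < e) (hf : 0 < f) (hef : e + f = 2 * c + 1) {t : ℝ} (ht : 0 ≤ t) (k : ℕ) :
    hyperTerm a b (c + t) (e + t) (f + t) k ≤ hyperTerm a b c e f k := by
  induction k with
  | zero => simp [hyperTerm_zero]
  | succ k ih =>
    have hk : (0 : ℝ) ≤ k := k.cast_nonneg
    have hc0 : 0 < c := by linarith
    rw [hyperTerm_succ he hf, hyperTerm_succ (by positivity) (by positivity)]
    refine mul_le_mul ih ?_ (by positivity) (hyperTerm_pos ha hb hc0 he hf k).le
    rw [div_le_div_iff₀ (by positivity) (by positivity)]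
    have key : (c + t + k) * ((e + k) * (f + k)) ≤ (c + k) * ((e + t + k) * (f + t + k)) := by
      obtain rfl : f = 2 * c + 1 - e := by linarith
      have h : 0 ≤ (c + k) ^ 2 - 1 / 4 := by nlinarith
      nlinarith [mul_nonneg ht h, mul_nonneg ht (sq_nonneg (e - c - 1 / 2)),
        mul_nonneg (sq_nonneg t) (add_nonneg hc0.le hk)]
    have := mul_le_mul_of_nonneg_left key
      (show 0 ≤ (a + k) * (b + k) * (k + 1) by positivity)
    linarith

/-- Whipple's summation theorem. -/
lemma whipple {a b c e f : ℝ} (ha : 0 < a) (hb : 0 < b) (hab : a + b = 1) (hc : 1 / 2 ≤ c)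
    (he : 0 < e) (hf : 0 < f) (hef : e + f = 2 * c + 1) :
    F32 a b c e f 1 =
      Gamma (e / 2) * Gamma ((e + 1) / 2) / (Gamma ((a + e) / 2) * Gamma ((b + e) / 2)) *
        (Gamma (f / 2) * Gamma ((f + 1) / 2) / (Gamma ((a + f) / 2) * Gamma ((b + f) / 2))) := by
  have hc0 : 0 < c := by linarith
  let r : ℝ → ℕ → ℝ := fun x n =>
    poch ((a + x) / 2) n * poch ((b + x) / 2) n / (poch (x / 2) n * poch ((x + 1) / 2) n)
  have hr : ∀ {x : ℝ}, 0 < x → ∀ n : ℕ, r x (n + 1) = r x n *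
      ((a + (x + 2 * n)) * (b + (x + 2 * n)) / ((x + 2 * n) * (x + 2 * n + 1))) := by
    intro x hx n
    have := (poch_pos (half_pos hx) n).ne'
    have := (poch_pos (show 0 < (x + 1) / 2 by positivity) n).ne'
    have : x + 2 * n ≠ 0 := by positivity
    have : x + 2 * n + 1 ≠ 0 := by positivity
    simp only [r, poch_succ]
    rw [show x / 2 + n = (x + 2 * n) / 2 by ring,
      show (x + 1) / 2 + n = (x + 2 * n + 1) / 2 by ring,
      show (a + x) / 2 + n = (a + (x + 2 * n)) / 2 by ring,
      show (b + x) / 2 + n = (b + (x + 2 * n)) / 2 by ring]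
    field_simp
  have hiter : ∀ n : ℕ, ∑' k, hyperTerm a b c e f k = r e n * r f n *
      ∑' k, hyperTerm a b (c + 2 * n) (e + 2 * n) (f + 2 * n) k := by
    intro n
    induction n with
    | zero => simp [r, poch_zero]
    | succ n ih =>
      rw [ih, whipple_double_step ha hb hab (by positivity) (by positivity) (by positivity)
        (by linarith), hr he, hr hf]
      push_cast
      simp only [mul_add, mul_one, ← add_assoc]
      ring
  have hlim : Tendsto (fun n : ℕ =>
      ∑' k, hyperTerm a b (c + 2 * n) (e + 2 * n) (f + 2 * n) k) atTop (𝓝 1) := by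
    refine tendsto_tsum_hyperTerm_one ha hb (fun n => by positivity) (fun n => by positivity)
      (fun n => by positivity) (summable_hyperTerm ha hb hc0 he hf (by linarith))
      (fun n k => hyperTerm_shift_le ha hb hc he hf hef (by positivity) k) fun k => ?_
    have h2 : ∀ x : ℝ, Tendsto (fun n : ℕ => x + 2 * (n : ℝ) + k) atTop atTop := fun x =>
      tendsto_atTop_add_const_right _ _ (tendsto_atTop_add_const_left _ _
        (tendsto_natCast_atTop_atTop.const_mul_atTop two_pos))
    have h3 := (((h2 e).inv_tendsto_atTop.const_mul (c - e)).const_add 1).mul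
      (h2 f).inv_tendsto_atTop
    rw [mul_zero] at h3
    refine h3.congr fun n => ?_
    have : e + 2 * n + k ≠ 0 := by positivity
    have : f + 2 * n + k ≠ 0 := by positivity
    simp only [Pi.inv_apply]
    field_simp
    ring
  have h := ((tendsto_poch_ratio (show 0 < (a + e) / 2 by positivity)
    (show 0 < (b + e) / 2 by positivity) (show 0 < e / 2 by positivity)
    (show 0 < (e + 1) / 2 by positivity) (by linarith)).mul
    (tendsto_poch_ratio (show 0 < (a + f) / 2 by positivity)
    (show 0 < (b + f) / 2 by positivity) (show 0 < f / 2 by positivity)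
    (show 0 < (f + 1) / 2 by positivity) (by linarith))).mul hlim
  rw [mul_one] at h
  rw [F32_one]
  exact tendsto_nhds_unique (tendsto_const_nhds.congr hiter) h

lemma F32_rotate (a b c e f z : ℝ) : F32 a b c e f z = F32 b c a f e z := by
  unfold F32
  refine tsum_congr fun k => ?_
  ring

lemma F32_reverse (a b c e f z : ℝ) : F32 a b c e f z = F32 c b a e f z := by
  unfold F32
  refine tsum_congr fun k => ?_
  ring

lemma P_one_sixth : P (1 / 6) (5 / 6) =
    π * Gamma (1 / 6) * Gamma (2 / 3) ^ 2 / (√π * Gamma (7 / 6) * Gamma (5 / 6)) *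
      F32 (1 / 3) (2 / 3) (1 / 2) (5 / 6) (7 / 6) 1 := by
  have h := thomae (a := 1 / 2) (b := 1 / 2) (c := 1 / 6) (d := 1) (e := 5 / 6) (s := 2 / 3)
    (by norm_num) (by norm_num) (by norm_num) (by norm_num) (by norm_num) (by norm_num)
    (by norm_num)
  rw [F32_rotate (1 - 1 / 2)] at h
  rw [P, h, betaR]
  norm_num [Gamma_one_half_eq]
  have := (Gamma_pos_of_pos (show (0 : ℝ) < 5 / 6 by norm_num)).ne'
  field_simp

lemma P_five_sixths : P (5 / 6) (7 / 6) =
    π * Gamma (1 / 3) ^ 2 / (√π * Gamma (7 / 6)) *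
      F32 (1 / 3) (2 / 3) (1 / 2) (5 / 6) (7 / 6) 1 := by
  have h := thomae (a := 1 / 2) (b := 1 / 2) (c := 5 / 6) (d := 1) (e := 7 / 6) (s := 1 / 3)
    (by norm_num) (by norm_num) (by norm_num) (by norm_num) (by norm_num) (by norm_num)
    (by norm_num)
  rw [F32_reverse (1 - 1 / 2)] at h
  rw [P, h, betaR]
  norm_num [Gamma_one_half_eq]
  have := (Gamma_pos_of_pos (show (0 : ℝ) < 5 / 6 by norm_num)).ne'
  have := (Gamma_pos_of_pos (show (0 : ℝ) < 7 / 6 by norm_num)).ne'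
  field_simp

lemma P_two_thirds : P (2 / 3) (4 / 3) =
    π * Gamma (2 / 3) ^ 2 / Gamma (7 / 6) ^ 2 *
      F32 (1 / 3) (2 / 3) (2 / 3) (7 / 6) (7 / 6) 1 := by
  have h := thomae (a := 2 / 3) (b := 1 / 2) (c := 1 / 2) (d := 1) (e := 4 / 3) (s := 2 / 3)
    (by norm_num) (by norm_num) (by norm_num) (by norm_num) (by norm_num) (by norm_num)
    (by norm_num)
  rw [P, F32_reverse, h, betaR]
  norm_num
  have := (Gamma_pos_of_pos (show (0 : ℝ) < 2 / 3 by norm_num)).ne'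
  have := (Gamma_pos_of_pos (show (0 : ℝ) < 4 / 3 by norm_num)).ne'
  field_simp

lemma sin_pi_div_twelve : sin (π / 12) = √2 * (√3 - 1) / 4 := by
  rw [show π / 12 = π / 3 - π / 4 by ring, sin_sub, sin_pi_div_three, cos_pi_div_three,
    sin_pi_div_four, cos_pi_div_four]
  ring

lemma two_rpow_one_third_mul_Gamma_one_third :
    (2 : ℝ) ^ ((1 : ℝ) / 3) * Gamma (1 / 3) ^ 2 * Gamma (5 / 6) =
      Gamma (2 / 3) ^ 2 * Gamma (1 / 6) := by
  have h1 := Gamma_mul_Gamma_add_half (1 / 6)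
  have h2 := Gamma_mul_Gamma_add_half (1 / 3)
  norm_num at h1 h2
  have h3 : (2 : ℝ) ^ ((2 : ℝ) / 3) = 2 ^ ((1 : ℝ) / 3) * 2 ^ ((1 : ℝ) / 3) := by
    rw [← rpow_add two_pos]
    norm_num
  rw [h3] at h1
  norm_num at h1 h2 ⊢
  linear_combination (2 : ℝ) ^ ((1 : ℝ) / 3) * Gamma (1 / 3) * h2 - Gamma (2 / 3) * h1

lemma two_rpow_one_third_mul_Gamma_one_sixth :
    (2 : ℝ) ^ ((1 : ℝ) / 3) * Gamma (1 / 6) * Gamma (11 / 12) =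
      (1 + √3) * √π * Gamma (7 / 12) := by
  have hsin : 0 < sin (π / 12) :=
    sin_pos_of_pos_of_lt_pi (by positivity) (by linarith [pi_pos])
  have h1 := Gamma_mul_Gamma_add_half (1 / 12)
  have h2 := Gamma_mul_Gamma_one_sub (1 / 12)
  rw [show π * (1 / 12) = π / 12 by ring, eq_div_iff hsin.ne', sin_pi_div_twelve] at h2
  norm_num at h1 h2
  have h3 : (2 : ℝ) ^ ((1 : ℝ) / 3) * √2 = 2 ^ ((5 : ℝ) / 6) := by
    rw [sqrt_eq_rpow, ← rpow_add two_pos]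
    norm_num
  have hg := Gamma_pos_of_pos (show (0 : ℝ) < 1 / 12 by norm_num)
  have hpi := sq_sqrt pi_pos.le
  have hs2 := sq_sqrt (show (0 : ℝ) ≤ 2 by norm_num)
  have hs3 := sq_sqrt (show (0 : ℝ) ≤ 3 by norm_num)
  have hp : 0 < √π := sqrt_pos.2 pi_pos
  rw [← h3] at h1
  have h4 : (1 + √3) * π = Gamma (1 / 12) * Gamma (11 / 12) * √2 / 2 := by
    linear_combination (-(1 + √3)) * h2 +
      Gamma (1 / 12) * Gamma (11 / 12) * √2 / 4 * hs3
  apply mul_left_cancel₀ (mul_ne_zero hg.ne' hp.ne')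
  linear_combination (-(Gamma (1 / 12) * Gamma (7 / 12) * (1 + √3))) * hpi -
    Gamma (1 / 12) * Gamma (7 / 12) * h4 - Gamma (1 / 12) * Gamma (11 / 12) * √2 / 2 * h1 -
    Gamma (1 / 12) * √π * 2 ^ ((1 : ℝ) / 3) * Gamma (1 / 6) * Gamma (11 / 12) / 2 * hs2

/-- `2^{1/3} · P(5/6, 7/6) = P(1/6, 5/6) = (1 + √3) · P(2/3, 4/3)`. -/
theorem P_relation_five_sixths :
    (2 : ℝ) ^ ((1 : ℝ)/3) * P (5/6) (7/6) = P (1/6) (5/6) ∧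
    P (1/6) (5/6) = (1 + Real.sqrt 3) * P (2/3) (4/3) := by
  have hg := fun {x : ℝ} (hx : 0 < x) => (Gamma_pos_of_pos hx).ne'
  have hp : √π ≠ 0 := (sqrt_pos.2 pi_pos).ne'
  have h56 := hg (show (0 : ℝ) < 5 / 6 by norm_num)
  have h76 := hg (show (0 : ℝ) < 7 / 6 by norm_num)
  constructor
  · rw [P_one_sixth, P_five_sixths]
    have h := two_rpow_one_third_mul_Gamma_one_third
    field_simp
    linear_combination F32 (1 / 3) (2 / 3) (1 / 2) (5 / 6) (7 / 6) 1 * h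
  · rw [P_one_sixth, P_two_thirds,
      whipple (by norm_num) (by norm_num) (by norm_num) (by norm_num) (by norm_num) (by norm_num)
        (by norm_num),
      whipple (by norm_num) (by norm_num) (by norm_num) (by norm_num) (by norm_num) (by norm_num)
        (by norm_num)]
    have h1 := two_rpow_one_third_mul_Gamma_one_sixth
    have h2 := Gamma_mul_Gamma_add_half (7 / 12)
    have h3 := Gamma_mul_Gamma_add_half (5 / 12)
    norm_num at h1 h2 h3 ⊢
    have h712 := hg (show (0 : ℝ) < 7 / 12 by norm_num)
    have h1112 := hg (show (0 : ℝ) < 11 / 12 by norm_num)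
    have h1312 := hg (show (0 : ℝ) < 13 / 12 by norm_num)
    have h34 := hg (show (0 : ℝ) < 3 / 4 by norm_num)
    have h23 := hg (show (0 : ℝ) < 2 / 3 by norm_num)
    field_simp
    have h4 : (2 : ℝ) ^ ((1 : ℝ) / 3) * 2 ^ (-((1 : ℝ) / 6)) = 2 ^ ((1 : ℝ) / 6) := by
      rw [← rpow_add two_pos]
      norm_num
    linear_combination Gamma (1 / 6) * Gamma (7 / 6) * Gamma (11 / 12) * h3 -
      √π * Gamma (5 / 6) * Gamma (7 / 12) * (1 + √3) * h2 +
      √π * Gamma (5 / 6) * Gamma (7 / 6) * 2 ^ (-((1 : ℝ) / 6)) * h1 -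
      √π * Gamma (5 / 6) * Gamma (7 / 6) * Gamma (1 / 6) * Gamma (11 / 12) * h4
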